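/- Let C be a chain complex of free abelian groups (a chain complex of ℤ-modules, indexed by the natural numbers, in which each term C_i is a free ℤ-module) such that every homology group H_i(C) is a finitely generated abelian group, and let G be a torsion abelian group. Then for every i ≥ 0 the cohomology group H^i(Hom_ℤ(C, G)) is a torsion group. -/

import Mathlib

open CategoryTheory

universe u

/-- A linear map into a torsion group is annihilated, on a finitely generated submodule, by a
positive integer. -/
lemma Submodule.FG.exists_nsmul_map_eq_zero {R M G : Type*} [CommRing R] [AddCommGroup M] [Module R M]
    [AddCommGroup G] [Module R G] (hG : IsAddTorsion G) {N : Submodule R M} (hN : N.FG)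
    (f : M →ₗ[R] G) : ∃ n : ℕ, 0 < n ∧ ∀ x ∈ N, n • f x = 0 := by
  induction N, hN using Submodule.fg_induction with
  | singleton x =>
    obtain ⟨n, hn, h⟩ := isOfFinAddOrder_iff_nsmul_eq_zero.mp (hG (f x))
    refine ⟨n, hn, fun y hy => ?_⟩
    obtain ⟨a, rfl⟩ := Submodule.mem_span_singleton.mp hy
    rw [map_smul, smul_comm, h, smul_zero]
  | sup N₁ N₂ _ _ h₁ h₂ =>
    obtain ⟨n₁, hn₁, h₁⟩ := h₁
    obtain ⟨n₂, hn₂, h₂⟩ := h₂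
    refine ⟨n₁ * n₂, Nat.mul_pos hn₁ hn₂, fun x hx => ?_⟩
    obtain ⟨y, hy, z, hz, rfl⟩ := Submodule.mem_sup.mp hx
    rw [map_add, smul_add, mul_comm, mul_smul, h₁ y hy, mul_comm, mul_smul, h₂ z hz]
    simp

/-- A linear map which vanishes on the kernel of a surjective linear map factors through it. -/
lemma LinearMap.exists_comp_eq_of_surjective {R M N P : Type*} [Ring R] [AddCommGroup M]
    [Module R M] [AddCommGroup N] [Module R N] [AddCommGroup P] [Module R P]
    {p : M →ₗ[R] N} (hp : Function.Surjective p) (f : M →ₗ[R] P) (hf : ker p ≤ ker f) :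
    ∃ g : N →ₗ[R] P, g ∘ₗ p = f := by
  refine ⟨(ker p).liftQ f hf ∘ₗ (p.quotKerEquivOfSurjective hp).symm.toLinearMap,
    LinearMap.ext fun x => ?_⟩
  have : (p.quotKerEquivOfSurjective hp).symm (p x) = (ker p).mkQ x := by
    rw [LinearEquiv.symm_apply_eq]; rfl
  simp only [LinearMap.comp_apply, LinearEquiv.coe_coe, this]
  rfl

/-- A quotient of an injective module over a principal ideal domain is injective. -/
lemma Module.Injective.of_surjective {R I Q : Type u} [CommRing R] [IsDomain R]
    [IsPrincipalIdealRing R] [AddCommGroup I] [Module R I] [AddCommGroup Q] [Module R Q]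
    (hI : Module.Injective R I) (f : I →ₗ[R] Q) (hf : Function.Surjective f) :
    Module.Injective R Q := by
  refine Module.Baer.injective fun J g => ?_
  obtain ⟨a, rfl⟩ := IsPrincipalIdealRing.principal J
  obtain rfl | ha := eq_or_ne a 0
  · refine ⟨0, fun x hx => ?_⟩
    have : (⟨x, hx⟩ : Submodule.span R {(0 : R)}) = 0 :=
      Subtype.ext (by simpa using hx)
    rw [this, map_zero, LinearMap.zero_apply]
  obtain ⟨y, hy⟩ := hf (g ⟨a, Submodule.mem_span_singleton_self a⟩)
  obtain ⟨h, hh⟩ := hI.out (LinearMap.toSpanSingleton R R a)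
    (fun x z hxz => mul_right_cancel₀ ha hxz) (LinearMap.toSpanSingleton R I y)
  refine ⟨f ∘ₗ h, fun x hx => ?_⟩
  obtain ⟨r, rfl⟩ := Submodule.mem_span_singleton.mp hx
  have hr : h (r • a) = r • y := hh r
  rw [LinearMap.comp_apply, hr, map_smul, hy, ← map_smul]
  rfl

/-- A submodule of a projective module over a principal ideal domain is projective. -/
lemma Module.Projective.submodule {R P : Type u} [CommRing R] [IsDomain R]
    [IsPrincipalIdealRing R] [AddCommGroup P] [Module R P] [Module.Projective R P]
    (N : Submodule R P) : Module.Projective R N := by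
  refine Module.Projective.of_lifting_property'' fun f hf => ?_
  obtain ⟨J⟩ := EnoughInjectives.presentation (ModuleCat.of R (N →₀ R))
  have hJ : Module.Injective R J.J :=
    (Module.injective_iff_injective_object R J.J).mpr J.injective
  let ι : (N →₀ R) →ₗ[R] J.J := J.f.hom
  have hι : Function.Injective ι := (ModuleCat.mono_iff_injective J.f).mp J.mono
  let K : Submodule R J.J := (LinearMap.ker f).map ι
  obtain ⟨g, hg⟩ := LinearMap.exists_comp_eq_of_surjective hf (K.mkQ ∘ₗ ι) fun x hx =>
    (Submodule.Quotient.mk_eq_zero K).mpr ⟨x, hx, rfl⟩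
  obtain ⟨g', hg'⟩ := (hJ.of_surjective K.mkQ K.mkQ_surjective).out N.subtype
    N.injective_subtype g
  obtain ⟨h, hh⟩ := Module.projective_lifting_property K.mkQ g' K.mkQ_surjective
  have key (n : N) : ∃ x, ι x = h n ∧ f x = n := by
    obtain ⟨x, rfl⟩ := hf n
    have : K.mkQ (h (f x)) = K.mkQ (ι x) :=
      (LinearMap.congr_fun hh _).trans ((hg' _).trans (LinearMap.congr_fun hg x))
    obtain ⟨k, hk, hkx⟩ := (Submodule.Quotient.eq K).mp this
    refine ⟨x + k, ?_, ?_⟩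
    · rw [map_add, hkx, add_sub_cancel]
    · rw [map_add, LinearMap.mem_ker.mp hk, add_zero]
  let s : N →ₗ[R] (N →₀ R) := (LinearEquiv.ofInjective ι hι).symm.toLinearMap ∘ₗ
    (h ∘ₗ N.subtype).codRestrict (LinearMap.range ι) fun n => (key n).imp fun _ hx => hx.1
  have hs (n : N) : ι (s n) = h n :=
    congrArg Subtype.val ((LinearEquiv.ofInjective ι hι).apply_symm_apply _)
  refine ⟨s, LinearMap.ext fun n => ?_⟩
  obtain ⟨x, hx, hxn⟩ := key n
  rw [LinearMap.comp_apply, hι ((hs n).trans hx.symm), hxn, LinearMap.id_apply]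

/-- A linear map into a torsion group which vanishes on the kernel of `b : M → N` has a positive
multiple which factors through `b`, provided that `b` is followed by a map `c : N → P` to a free
module such that `ker c / range b` is finitely generated. -/
lemma LinearMap.exists_nsmul_eq_comp {R P : Type u} {M N G : Type*}
    [CommRing R] [IsDomain R] [IsPrincipalIdealRing R]
    [AddCommGroup M] [Module R M] [AddCommGroup N] [Module R N]
    [AddCommGroup P] [Module R P] [Module.Free R P] [AddCommGroup G] [Module R G]
    (hG : IsAddTorsion G) (b : M →ₗ[R] N) (c : N →ₗ[R] P) (hcb : c ∘ₗ b = 0)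
    {T : Submodule R N} (hT : T.FG) (hTc : T ≤ ker c) (hc : ker c ≤ T ⊔ range b)
    (f : M →ₗ[R] G) (hf : ker b ≤ ker f) :
    ∃ n : ℕ, 0 < n ∧ ∃ g : N →ₗ[R] G, n • f = g ∘ₗ b := by
  obtain ⟨n, hn, hnf⟩ : ∃ n : ℕ, 0 < n ∧ ∀ x, b x ∈ T → n • f x = 0 := by
    obtain ⟨h, hh⟩ := LinearMap.exists_comp_eq_of_surjective b.surjective_rangeRestrict f
      (by rwa [b.ker_rangeRestrict])
    have : IsNoetherian R T := isNoetherian_of_fg_of_noetherian T hT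
    have hfg : (T.comap (range b).subtype).FG := by
      refine Submodule.fg_of_fg_map_injective _ (range b).injective_subtype ?_
      exact hT.of_le (Submodule.map_comap_le _ _)
    obtain ⟨n, hn, hn'⟩ := hfg.exists_nsmul_map_eq_zero hG h
    exact ⟨n, hn, fun x hx => by rw [← hh]; exact hn' _ hx⟩
  let φ : M × T →ₗ[R] ker c :=
    (b.codRestrict _ fun x => LinearMap.congr_fun hcb x).coprod (Submodule.inclusion hTc)
  have hφ : Function.Surjective φ := by
    rintro ⟨x, hx⟩
    obtain ⟨t, ht, _, ⟨y, rfl⟩, rfl⟩ := Submodule.mem_sup.mp (hc hx)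
    exact ⟨(y, ⟨t, ht⟩), Subtype.ext (add_comm _ _)⟩
  have hker : ker φ ≤ ker ((n • f) ∘ₗ fst R M T) := by
    rintro ⟨x, t⟩ h
    have h' : b x + t = 0 := congrArg Subtype.val h
    refine hnf x ?_
    rw [eq_neg_of_add_eq_zero_left h']
    exact T.neg_mem t.2
  obtain ⟨k, hk⟩ := LinearMap.exists_comp_eq_of_surjective hφ _ hker
  have : Module.Projective R (range c) := Module.Projective.submodule _
  obtain ⟨s, hs⟩ := c.rangeRestrict.exists_rightInverse_of_surjective c.range_rangeRestrict
  have hs' (y : range c) : c (s y) = y := congrArg Subtype.val (LinearMap.congr_fun hs y)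
  let r : N →ₗ[R] ker c := (LinearMap.id - s ∘ₗ c.rangeRestrict).codRestrict _ fun x => by
    simp [hs']
  refine ⟨n, hn, k ∘ₗ r, LinearMap.ext fun x => ?_⟩
  have hr : r (b x) = φ (x, 0) := by
    have hcbx : c.rangeRestrict (b x) = 0 := Subtype.ext (LinearMap.congr_fun hcb x)
    refine Subtype.ext ?_
    simp [r, φ, hcbx]
    rfl
  rw [LinearMap.comp_apply, LinearMap.comp_apply, hr]
  exact (LinearMap.congr_fun hk (x, 0)).symm

namespace CategoryTheory.ShortComplex

/-- If the homology of a short complex of modules is finitely generated, then the cycles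
are generated by the boundaries and a finitely generated submodule. -/
lemma exists_fg_ker_le_sup_range {R : Type*} [Ring R] (S : ShortComplex (ModuleCat R))
    (h : Module.Finite R S.homology) :
    ∃ T : Submodule R S.X₂, T.FG ∧ T ≤ LinearMap.ker S.g.hom ∧
      LinearMap.ker S.g.hom ≤ T ⊔ LinearMap.range S.f.hom := by
  have : Module.Finite R (LinearMap.ker S.g.hom ⧸ LinearMap.range S.moduleCatToCycles) :=
    Module.Finite.equiv S.moduleCatHomologyIso.toLinearEquiv
  obtain ⟨n, p, hp⟩ := Module.Finite.exists_fin' R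
    (LinearMap.ker S.g.hom ⧸ LinearMap.range S.moduleCatToCycles)
  obtain ⟨q, hq⟩ := Module.projective_lifting_property
    (LinearMap.range S.moduleCatToCycles).mkQ p (Submodule.mkQ_surjective _)
  refine ⟨LinearMap.range ((LinearMap.ker S.g.hom).subtype ∘ₗ q), ?_, ?_, fun x hx => ?_⟩
  · exact Submodule.fg_range _
  · rintro _ ⟨y, rfl⟩
    exact (q y).2
  · obtain ⟨y, hy⟩ := hp ((LinearMap.range S.moduleCatToCycles).mkQ ⟨x, hx⟩)
    rw [← hq, LinearMap.comp_apply] at hy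
    obtain ⟨z, hz⟩ := (Submodule.Quotient.eq _).mp hy.symm
    refine Submodule.mem_sup.mpr ⟨_, ⟨y, rfl⟩, _, ⟨z, rfl⟩, ?_⟩
    have hz' : S.f.hom z = x - (q y : S.X₂) := congrArg Subtype.val hz
    simp [hz']

/-- The homology of a short complex of modules is torsion if every cycle has a positive
multiple which is a boundary. -/
lemma isAddTorsion_homology {R : Type*} [Ring R] (S : ShortComplex (ModuleCat R))
    (h : ∀ x : S.X₂, S.g x = 0 → ∃ n : ℕ, 0 < n ∧ ∃ y : S.X₁, S.f y = n • x) :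
    IsAddTorsion S.homology := by
  intro x
  obtain ⟨⟨z, hz⟩, hzx⟩ := Submodule.mkQ_surjective (LinearMap.range S.moduleCatToCycles)
    (S.moduleCatHomologyIso.toLinearEquiv x)
  obtain ⟨n, hn, y, hy⟩ := h z hz
  refine isOfFinAddOrder_iff_nsmul_eq_zero.mpr ⟨n, hn, ?_⟩
  apply S.moduleCatHomologyIso.toLinearEquiv.injective
  rw [map_nsmul, ← hzx, map_zero]
  exact (Submodule.Quotient.mk_eq_zero (LinearMap.range S.moduleCatToCycles)
    (x := n • (⟨z, hz⟩ : LinearMap.ker S.g.hom))).mpr ⟨y, Subtype.ext hy⟩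

end CategoryTheory.ShortComplex

/-- Let `C` be a chain complex of free abelian groups (indexed by `ℕ`) all of whose
homology groups are finitely generated, and let `G` be a torsion abelian group. Then
every cohomology group `H^i(Hom_ℤ(C, G))` of the cochain complex `Hom_ℤ(C, G)` is a
torsion group. -/
theorem cohomology_isTorsion_of_torsion_coefficients
    (C : ChainComplex (ModuleCat ℤ) ℕ)
    (hfree : ∀ i, Module.Free ℤ (C.X i))
    (hfg : ∀ i, AddGroup.FG (C.homology i))
    (G : Type) [AddCommGroup G] (hG : AddMonoid.IsTorsion G) (i : ℕ) :
    AddMonoid.IsTorsion ((C.linearYonedaObj ℤ (ModuleCat.of ℤ G)).homology i) := by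
  have hfin (j : ℕ) : Module.Finite ℤ (C.homology j) := by
    have := Module.Finite.iff_addGroup_fg.mpr (hfg j)
    convert this
    exact Subsingleton.elim _ _
  refine ShortComplex.isAddTorsion_homology _ fun (f : C.X i ⟶ ModuleCat.of ℤ G) hf => ?_
  have hd : C.d ((ComplexShape.down ℕ).prev i) i ≫ f = 0 := hf
  obtain ⟨n, hn, hnf⟩ : ∃ n : ℕ, 0 < n ∧
      ∀ x ∈ LinearMap.ker (C.d i ((ComplexShape.down ℕ).next i)).hom, n • f.hom x = 0 := by
    obtain ⟨T, hT, -, hle⟩ := (C.sc i).exists_fg_ker_le_sup_range (hfin i)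
    obtain ⟨n, hn, h⟩ := hT.exists_nsmul_map_eq_zero hG f.hom
    refine ⟨n, hn, fun x hx => ?_⟩
    obtain ⟨t, ht, _, ⟨z, rfl⟩, rfl⟩ := Submodule.mem_sup.mp (hle hx)
    have hz : f.hom ((C.sc i).f.hom z) = 0 := congr($hd z)
    have hadd := (f.hom.map_add t _).trans (congrArg (f.hom t + ·) hz)
    exact (congrArg (n • ·) (hadd.trans (add_zero _))).trans (h t ht)
  suffices ∃ m : ℕ, 0 < m ∧ ∃ g : C.X ((ComplexShape.down ℕ).next i) ⟶ ModuleCat.of ℤ G,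
      C.d i ((ComplexShape.down ℕ).next i) ≫ g = m • f from this
  cases i with
  | zero =>
    refine ⟨n, hn, 0, ?_⟩
    ext x
    refine (hnf x ?_).symm
    simp
  | succ i =>
    rw [ChainComplex.next_nat_succ] at hnf ⊢
    obtain ⟨T, hT, hTc, hle⟩ := (C.sc i).exists_fg_ker_le_sup_range (hfin i)
    have hle' : LinearMap.ker (C.d i ((ComplexShape.down ℕ).next i)).hom ≤
        T ⊔ LinearMap.range (C.d ((ComplexShape.down ℕ).prev i) i).hom := hle
    rw [ChainComplex.prev] at hle'
    have := hfree ((ComplexShape.down ℕ).next i)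
    obtain ⟨m, hm, g, hg⟩ := LinearMap.exists_nsmul_eq_comp hG (C.d (i + 1) i).hom
      (C.d i ((ComplexShape.down ℕ).next i)).hom
      (by rw [← ModuleCat.hom_comp, C.d_comp_d, ModuleCat.hom_zero]) hT hTc hle' (n • f.hom) hnf
    refine ⟨m * n, Nat.mul_pos hm hn, ModuleCat.ofHom g, ?_⟩
    ext x
    have hx := LinearMap.congr_fun hg x
    simp only [LinearMap.smul_apply, LinearMap.comp_apply] at hx
    simp [mul_smul, hx]
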